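/- Let T > 0, let d ≥ 1 be an integer, and let Q be a d×d matrix with nonnegative entries. For f, g ∈ C([0,T],ℝ^d) define S(f,g) ∈ C([0,T],ℝ^d) by S(f,g)_i(t) = sup_{0≤s≤t} ((f(s)Q)_i − g_i(s))_+. Then for all f, f̃, g, g̃ ∈ C([0,T],ℝ^d) one has ‖S(f,g) − S(f̃,g̃)‖_{T,max} ≤ ‖Q‖_cs · ‖f − f̃‖_{T,max} + ‖g − g̃‖_{T,max}. -/

import Mathlib

open scoped BigOperators

/-- The `‖·‖_{T,max}` norm of a path `f : [0,T] → ℝ^d`. -/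
noncomputable def normTmax (T : ℝ) {d : ℕ} (f : ℝ → Fin d → ℝ) : ℝ :=
  ⨆ i : Fin d, ⨆ t : Set.Icc (0 : ℝ) T, |f t.1 i|

/-- The maximal column sum norm `‖Q‖_cs` of a `d × d` matrix. -/
noncomputable def csNorm {d : ℕ} (Q : Matrix (Fin d) (Fin d) ℝ) : ℝ :=
  ⨆ j : Fin d, ∑ i : Fin d, |Q i j|

theorem abs_ciSup_sub_ciSup_le {ι : Type*} [Nonempty ι] {a b : ι → ℝ} {C : ℝ}
    (ha : BddAbove (Set.range a)) (hb : BddAbove (Set.range b))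
    (h : ∀ s, |a s - b s| ≤ C) : |(⨆ s, a s) - ⨆ s, b s| ≤ C := by
  have hab : (⨆ s, a s) ≤ (⨆ s, b s) + C := ciSup_le fun s => by
    linarith [(abs_le.mp (h s)).2, le_ciSup hb s]
  have hba : (⨆ s, b s) ≤ (⨆ s, a s) + C := ciSup_le fun s => by
    linarith [(abs_le.mp (h s)).1, le_ciSup ha s]
  exact abs_le.mpr ⟨by linarith, by linarith⟩

theorem bddAbove_range_Icc {T t : ℝ} (htT : t ≤ T) {h : ℝ → ℝ}
    (hh : ContinuousOn h (Set.Icc 0 T)) :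
    BddAbove (Set.range fun s : Set.Icc (0 : ℝ) t => h s.1) := by
  refine (isCompact_Icc.bddAbove_image hh).mono ?_
  rintro _ ⟨s, rfl⟩
  exact ⟨s.1, ⟨s.2.1, s.2.2.trans htT⟩, rfl⟩

theorem abs_le_normTmax {T : ℝ} {d : ℕ} {f : ℝ → Fin d → ℝ}
    (hf : ContinuousOn f (Set.Icc 0 T)) {t : ℝ} (ht : t ∈ Set.Icc 0 T) (i : Fin d) :
    |f t i| ≤ normTmax T f :=
  (le_ciSup (bddAbove_range_Icc le_rfl (continuousOn_pi.mp hf i).abs) ⟨t, ht⟩).trans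
    (le_ciSup (f := fun i => ⨆ t : Set.Icc (0 : ℝ) T, |f t.1 i|) (Set.finite_range _).bddAbove i)

theorem normTmax_nonneg (T : ℝ) {d : ℕ} (f : ℝ → Fin d → ℝ) : 0 ≤ normTmax T f :=
  Real.iSup_nonneg fun _ => Real.iSup_nonneg fun _ => abs_nonneg _

theorem abs_sum_mul_le_csNorm_mul {d : ℕ} (Q : Matrix (Fin d) (Fin d) ℝ) {y : Fin d → ℝ}
    {C : ℝ} (hC : 0 ≤ C) (hy : ∀ j, |y j| ≤ C) (i : Fin d) :
    |∑ j, y j * Q j i| ≤ csNorm Q * C :=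
  calc |∑ j, y j * Q j i| ≤ ∑ j, |y j * Q j i| := Finset.abs_sum_le_sum_abs _ _
    _ ≤ ∑ j, |Q j i| * C := Finset.sum_le_sum fun j _ => by
        rw [abs_mul, mul_comm]
        exact mul_le_mul_of_nonneg_left (hy j) (abs_nonneg _)
    _ = (∑ j, |Q j i|) * C := (Finset.sum_mul _ _ _).symm
    _ ≤ csNorm Q * C := mul_le_mul_of_nonneg_right
        (le_ciSup (f := fun i => ∑ j, |Q j i|) (Set.finite_range _).bddAbove i) hC

theorem continuousOn_reflection {T : ℝ} {d : ℕ} (Q : Matrix (Fin d) (Fin d) ℝ)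
    {f g : ℝ → Fin d → ℝ} (hf : ContinuousOn f (Set.Icc 0 T))
    (hg : ContinuousOn g (Set.Icc 0 T)) (i : Fin d) :
    ContinuousOn (fun s => max ((∑ j, f s j * Q j i) - g s i) 0) (Set.Icc 0 T) := by
  have hfj := fun j => continuousOn_pi.mp hf j
  have hgi := continuousOn_pi.mp hg i
  fun_prop

/-- one step of the Skorokhod iteration map
`S(f,g)_i(t) = sup_{0 ≤ s ≤ t} ((f(s)Q)_i − g_i(s))₊` satisfies
`‖S(f,g) − S(f̃,g̃)‖_{T,max} ≤ ‖Q‖_cs ‖f − f̃‖_{T,max} + ‖g − g̃‖_{T,max}`. -/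
theorem iteration_step_estimate
    (T : ℝ) (hT : 0 < T) (d : ℕ) (hd : 1 ≤ d)
    (Q : Matrix (Fin d) (Fin d) ℝ) (hQnn : ∀ i j, 0 ≤ Q i j)
    (S : (ℝ → Fin d → ℝ) → (ℝ → Fin d → ℝ) → ℝ → Fin d → ℝ)
    (hS : ∀ f g t i, S f g t i =
      ⨆ s : Set.Icc (0 : ℝ) t, max ((∑ j, f s.1 j * Q j i) - g s.1 i) 0)
    (f f' g g' : ℝ → Fin d → ℝ)
    (hf : ContinuousOn f (Set.Icc 0 T)) (hf' : ContinuousOn f' (Set.Icc 0 T))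
    (hg : ContinuousOn g (Set.Icc 0 T)) (hg' : ContinuousOn g' (Set.Icc 0 T)) :
    normTmax T (fun t i => S f g t i - S f' g' t i) ≤
      csNorm Q * normTmax T (fun t i => f t i - f' t i) +
        normTmax T (fun t i => g t i - g' t i) := by
  have : Nonempty (Fin d) := ⟨⟨0, hd⟩⟩
  have : Nonempty (Set.Icc (0 : ℝ) T) := ⟨⟨0, le_rfl, hT.le⟩⟩
  refine ciSup_le fun i => ciSup_le fun t => ?_
  have : Nonempty (Set.Icc (0 : ℝ) t.1) := ⟨⟨0, le_rfl, t.2.1⟩⟩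
  beta_reduce
  rw [hS, hS]
  refine abs_ciSup_sub_ciSup_le
    (bddAbove_range_Icc t.2.2 (continuousOn_reflection Q hf hg i))
    (bddAbove_range_Icc t.2.2 (continuousOn_reflection Q hf' hg' i)) fun s => ?_
  have hs : s.1 ∈ Set.Icc 0 T := ⟨s.2.1, s.2.2.trans t.2.2⟩
  have hfQ := abs_sum_mul_le_csNorm_mul Q
    (normTmax_nonneg T fun t i => f t i - f' t i) (abs_le_normTmax (hf.sub hf') hs) i
  have hgg : |g s.1 i - g' s.1 i| ≤ normTmax T (fun t i => g t i - g' t i) :=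
    abs_le_normTmax (hg.sub hg') hs i
  refine (abs_max_sub_max_le_abs _ _ _).trans ?_
  have hsplit : (∑ j, f s.1 j * Q j i) - g s.1 i - ((∑ j, f' s.1 j * Q j i) - g' s.1 i) =
      (∑ j, (f - f') s.1 j * Q j i) - (g s.1 i - g' s.1 i) := by
    simp only [Pi.sub_apply, sub_mul, Finset.sum_sub_distrib]
    ring
  rw [hsplit]
  exact (abs_sub _ _).trans (add_le_add hfQ hgg)
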